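/- Let P ⊆ ℝ^d be a polytope of dimension n ≥ 1 such that every edge of P meets every facet of P (i.e., E ∩ F ≠ ∅ for each edge E and each facet F of P). Then P is a simplex. -/

import Mathlib

/-- A (nonempty) face of the polytope `P`: a nonempty exposed subset of `P`. -/
def IsPolytopeFace {d : ℕ} (P F : Set (Fin d → ℝ)) : Prop :=
  F.Nonempty ∧ IsExposed ℝ P F

/-- The dimension of a subset of `ℝ^d`: the dimension of its affine span, i.e. the
rank of the vector span of its direction. -/
noncomputable def setDim {d : ℕ} (S : Set (Fin d → ℝ)) : ℕ :=
  Module.finrank ℝ (vectorSpan ℝ S)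

open Classical in
/-- Maximisers of `l` on `s`. -/
noncomputable def argM {d : ℕ} (s : Finset (Fin d → ℝ)) (l : (Fin d → ℝ) →L[ℝ] ℝ) :
    Finset (Fin d → ℝ) := s.filter (fun x => ∀ y ∈ s, l y ≤ l x)

theorem mem_argM {d : ℕ} {s : Finset (Fin d → ℝ)} {l : (Fin d → ℝ) →L[ℝ] ℝ} {x : Fin d → ℝ} :
    x ∈ argM s l ↔ x ∈ s ∧ ∀ y ∈ s, l y ≤ l x := by
  classical
  simp [argM]

theorem argM_nonempty {d : ℕ} {s : Finset (Fin d → ℝ)} (hs : s.Nonempty)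
    (l : (Fin d → ℝ) →L[ℝ] ℝ) : (argM s l).Nonempty := by
  obtain ⟨x, hx, h⟩ := s.exists_max_image l hs
  exact ⟨x, mem_argM.2 ⟨hx, h⟩⟩

theorem le_on_hull {d : ℕ} {s : Finset (Fin d → ℝ)} {l : (Fin d → ℝ) →L[ℝ] ℝ} {c : ℝ}
    (h : ∀ y ∈ s, l y ≤ c) {x : Fin d → ℝ} (hx : x ∈ convexHull ℝ (s : Set (Fin d → ℝ))) :
    l x ≤ c := by
  have : convexHull ℝ (s : Set (Fin d → ℝ)) ⊆ {x | l x ≤ c} :=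
    convexHull_min (fun y hy => h y hy) (convex_halfSpace_le l.isLinear c)
  exact this hx

theorem face_eq {d : ℕ} {s : Finset (Fin d → ℝ)} (hs : s.Nonempty)
    (l : (Fin d → ℝ) →L[ℝ] ℝ) :
    convexHull ℝ (argM s l : Set (Fin d → ℝ)) =
      {x ∈ convexHull ℝ (s : Set (Fin d → ℝ)) |
        ∀ y ∈ convexHull ℝ (s : Set (Fin d → ℝ)), l y ≤ l x} := by
  classical
  obtain ⟨m, hm⟩ := argM_nonempty hs l
  have hm' := mem_argM.1 hm
  apply Set.Subset.antisymm
  · intro x hx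
    refine ⟨convexHull_mono (fun y hy => (mem_argM.1 hy).1) hx, fun y hy => ?_⟩
    have h1 : l y ≤ l m := le_on_hull hm'.2 hy
    have h2 : (-l) x ≤ - l m := le_on_hull (fun z hz => by
      have := (mem_argM.1 hz).2 m hm'.1
      simpa using this) hx
    simp at h2
    linarith
  · rintro x ⟨hx, hmax⟩
    have hxm : l m ≤ l x := hmax m (subset_convexHull ℝ _ hm'.1)
    rw [Finset.mem_convexHull'] at hx ⊢
    obtain ⟨w, hw0, hw1, hwx⟩ := hx
    have hz : ∑ y ∈ s, w y * (l m - l y) ≤ 0 := by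
      have : l x = ∑ y ∈ s, w y * l y := by
        rw [← hwx]; simp
      simp only [mul_sub, Finset.sum_sub_distrib, ← Finset.sum_mul, hw1]
      linarith
    have hnn : ∀ y ∈ s, 0 ≤ w y * (l m - l y) := fun y hy =>
      mul_nonneg (hw0 y hy) (sub_nonneg.2 (hm'.2 y hy))
    have hz0 := (Finset.sum_eq_zero_iff_of_nonneg hnn).1 (le_antisymm hz (Finset.sum_nonneg hnn))
    have hsub : argM s l ⊆ s := fun y hy => (mem_argM.1 hy).1
    have hw : ∀ y ∈ s, y ∉ argM s l → w y = 0 := by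
      intro y hy hyn
      rcases mul_eq_zero.1 (hz0 y hy) with h | h
      · exact h
      · exact absurd (mem_argM.2 ⟨hy, fun z hz => by have := hm'.2 z hz; linarith⟩) hyn
    refine ⟨w, fun y hy => hw0 y (hsub hy), ?_, ?_⟩
    · rw [← hw1]; exact Finset.sum_subset hsub hw
    · rw [← hwx]; exact Finset.sum_subset hsub (fun y hy hn => by simp [hw y hy hn])

theorem face_isFace {d : ℕ} {s : Finset (Fin d → ℝ)} (hs : s.Nonempty)
    (l : (Fin d → ℝ) →L[ℝ] ℝ) :
    IsPolytopeFace (convexHull ℝ (s : Set (Fin d → ℝ)))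
      (convexHull ℝ (argM s l : Set (Fin d → ℝ))) := by
  refine ⟨?_, fun _ => ⟨l, face_eq hs l⟩⟩
  obtain ⟨m, hm⟩ := argM_nonempty hs l
  exact ⟨m, subset_convexHull ℝ _ hm⟩

theorem setDim_hull {d : ℕ} (s : Set (Fin d → ℝ)) :
    setDim (convexHull ℝ s) = Module.finrank ℝ (vectorSpan ℝ s) := by
  unfold setDim
  rw [← direction_affineSpan, affineSpan_convexHull, direction_affineSpan]

theorem tilt {d : ℕ} (s : Finset (Fin d → ℝ)) (hs : s.Nonempty)
    (k g : (Fin d → ℝ) →L[ℝ] ℝ) : ∃ l, argM s l = argM (argM s k) g := by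
  have hev : ∀ᶠ N : ℝ in Filter.atTop, ∀ x ∈ s, ∀ y ∈ s, k y < k x →
      N * k y + g y < N * k x + g x := by
    rw [Filter.eventually_all_finset]
    intro x hx
    rw [Filter.eventually_all_finset]
    intro y hy
    by_cases h : k y < k x
    · filter_upwards [Filter.eventually_gt_atTop ((g y - g x) / (k x - k y))] with N hN _
      rw [div_lt_iff₀ (by linarith)] at hN
      nlinarith
    · exact Filter.Eventually.of_forall fun N h' => absurd h' h
  obtain ⟨N, hN⟩ := hev.exists
  refine ⟨N • k + g, ?_⟩
  obtain ⟨m, hm⟩ := argM_nonempty hs k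
  have hm' := mem_argM.1 hm
  ext x
  rw [mem_argM, mem_argM]
  simp only [add_apply, smul_apply, smul_eq_mul]
  constructor
  · rintro ⟨hx, h⟩
    have hxk : x ∈ argM s k := by
      refine mem_argM.2 ⟨hx, fun y hy => ?_⟩
      by_contra hc
      have := hN y hy x hx (by linarith)
      have := h y hy
      linarith
    refine ⟨hxk, fun y hy => ?_⟩
    have e1 := (mem_argM.1 hxk).2 y (mem_argM.1 hy).1
    have e2 := (mem_argM.1 hy).2 x hx
    have e : k x = k y := le_antisymm e2 e1
    have := h y (mem_argM.1 hy).1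
    rw [e] at this
    linarith
  · rintro ⟨hxk, h⟩
    have hx := mem_argM.1 hxk
    refine ⟨hx.1, fun y hy => ?_⟩
    rcases lt_or_eq_of_le (hx.2 y hy) with h1 | h1
    · exact (hN x hx.1 y hy h1).le
    · have : y ∈ argM s k := mem_argM.2 ⟨hy, fun z hz => by rw [h1]; exact hx.2 z hz⟩
      have := h y this
      rw [h1]; linarith

theorem grow {d : ℕ} (s : Finset (Fin d → ℝ)) (v : Fin d → ℝ) (hv : v ∈ s)
    (l h : (Fin d → ℝ) →L[ℝ] ℝ) (hvl : v ∉ argM s l)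
    (hc : ∀ x ∈ argM s l, h x = h v) (z : Fin d → ℝ) (hz : z ∈ s) (hzv : h v < h z) :
    ∃ l', v ∉ argM s l' ∧ argM s l ⊂ argM s l' := by
  classical
  obtain ⟨m, hm⟩ := argM_nonempty ⟨v, hv⟩ l
  have hm' := mem_argM.1 hm
  have hvm : l v < l m := by
    by_contra hcon
    exact hvl (mem_argM.2 ⟨hv, fun y hy => by have := hm'.2 y hy; linarith⟩)
  obtain ⟨x0, hx0, hmin⟩ := (s.filter (fun x => h v < h x)).exists_min_image
    (fun x => (l m - l x) / (h x - h v)) ⟨z, by simp [hz, hzv]⟩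
  rw [Finset.mem_filter] at hx0
  set t := (l m - l x0) / (h x0 - h v) with ht
  have ht0 : 0 ≤ t := div_nonneg (by linarith [hm'.2 x0 hx0.1]) (by linarith)
  have hx0t : t * (h x0 - h v) = l m - l x0 := div_mul_cancel₀ _ (by linarith)
  have hle : ∀ y ∈ s, (l + t • h) y ≤ l m + t * h v := by
    intro y hy
    simp only [add_apply, smul_apply, smul_eq_mul]
    have := hm'.2 y hy
    by_cases hyv : h v < h y
    · have := hmin y (by simp [hy, hyv])
      rw [le_div_iff₀ (by linarith)] at this
      linarith
    · nlinarith
  have hx0M : x0 ∈ argM s (l + t • h) := by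
    refine mem_argM.2 ⟨hx0.1, fun y hy => (hle y hy).trans ?_⟩
    simp only [add_apply, smul_apply, smul_eq_mul]
    linarith
  refine ⟨l + t • h, fun hcon => ?_, ?_⟩
  · have := (mem_argM.1 hcon).2 m hm'.1
    simp only [add_apply, smul_apply, smul_eq_mul,
      hc m hm] at this
    linarith
  · rw [Finset.ssubset_iff_of_subset]
    · refine ⟨x0, hx0M, fun hcon => ?_⟩
      have := hc x0 hcon
      linarith [hx0.2]
    · intro x hx
      refine mem_argM.2 ⟨(mem_argM.1 hx).1, fun y hy => (hle y hy).trans ?_⟩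
      simp only [add_apply, smul_apply, smul_eq_mul,
        hc x hx]
      linarith [(mem_argM.1 hx).2 m hm'.1]

theorem facet_exists {d : ℕ} (s : Finset (Fin d → ℝ)) (v : Fin d → ℝ) (hv : v ∈ s)
    (hne : ∃ x ∈ s, x ≠ v) : ∃ l, v ∉ argM s l ∧
      Module.finrank ℝ (vectorSpan ℝ (argM s l : Set (Fin d → ℝ))) + 1 =
        Module.finrank ℝ (vectorSpan ℝ (s : Set (Fin d → ℝ))) := by
  classical
  obtain ⟨x, hx, hxv⟩ := hne
  obtain ⟨l0, hl0⟩ : ∃ l : (Fin d → ℝ) →L[ℝ] ℝ, v ∉ argM s l := by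
    obtain ⟨l, hl⟩ := geometric_hahn_banach_point_point hxv.symm
    exact ⟨l, fun h => by have := (mem_argM.1 h).2 x hx; linarith⟩
  let A := s.powerset.filter (fun t => ∃ l, v ∉ argM s l ∧ t = argM s l)
  obtain ⟨t, htA, hmax⟩ := A.exists_max_image Finset.card
    ⟨argM s l0, by
      simp only [A, Finset.mem_filter, Finset.mem_powerset]
      exact ⟨fun y hy => (mem_argM.1 hy).1, l0, hl0, rfl⟩⟩
  simp only [A, Finset.mem_filter, Finset.mem_powerset] at htA hmax
  obtain ⟨hts, l, hvl, rfl⟩ := htA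
  refine ⟨l, hvl, ?_⟩
  have hspan : ∀ z ∈ s, z - v ∈ vectorSpan ℝ (insert v (argM s l : Set (Fin d → ℝ))) := by
    intro z hz
    by_contra hcon
    obtain ⟨f, hf, hW⟩ := Submodule.exists_le_ker_of_notMem hcon
    have hconst : ∀ y ∈ argM s l, f y = f v := by
      intro y hy
      have : y - v ∈ vectorSpan ℝ (insert v (argM s l : Set (Fin d → ℝ))) :=
        vsub_mem_vectorSpan ℝ (Set.mem_insert_of_mem _ hy) (Set.mem_insert _ _)
      have := hW this
      rw [LinearMap.mem_ker, map_sub] at this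
      linarith
    rw [map_sub] at hf
    have key : ∃ h : (Fin d → ℝ) →L[ℝ] ℝ, (∀ y ∈ argM s l, h y = h v) ∧ h v < h z := by
      rcases lt_or_gt_of_ne (sub_ne_zero.1 hf) with h1 | h1
      · exact ⟨-(LinearMap.toContinuousLinearMap f), fun y hy => by simp [hconst y hy],
          by simpa using h1⟩
      · exact ⟨LinearMap.toContinuousLinearMap f, fun y hy => by simp [hconst y hy],
          by simpa using h1⟩
    obtain ⟨h, hc, hzv⟩ := key
    obtain ⟨l', hvl', hss⟩ := grow s v hv l h hvl hc z hz hzv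
    have := hmax (argM s l') ⟨fun y hy => (mem_argM.1 hy).1, l', hvl', rfl⟩
    have := Finset.card_lt_card hss
    omega
  have heq : vectorSpan ℝ (s : Set (Fin d → ℝ)) =
      vectorSpan ℝ (insert v (argM s l : Set (Fin d → ℝ))) := by
    apply le_antisymm
    · rw [vectorSpan_eq_span_vsub_set_right ℝ (show v ∈ (s : Set (Fin d → ℝ)) from hv),
        Submodule.span_le]
      rintro _ ⟨z, hz, rfl⟩
      exact hspan z hz
    · apply vectorSpan_mono
      apply Set.insert_subset hv
      exact_mod_cast hts
  rw [heq]
  apply le_antisymm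
  · obtain ⟨m, hm⟩ := argM_nonempty ⟨v, hv⟩ l
    have hm' := mem_argM.1 hm
    apply Nat.succ_le_of_lt
    apply Submodule.finrank_lt_finrank_of_lt
    refine lt_of_le_of_ne (vectorSpan_mono ℝ (Set.subset_insert _ _)) fun hE => ?_
    have h1 : v - m ∈ vectorSpan ℝ (insert v (argM s l : Set (Fin d → ℝ))) :=
      vsub_mem_vectorSpan ℝ (Set.mem_insert _ _) (Set.mem_insert_of_mem _ hm)
    rw [← hE] at h1
    have h2 : vectorSpan ℝ (argM s l : Set (Fin d → ℝ)) ≤ LinearMap.ker l.toLinearMap := by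
      rw [vectorSpan, Submodule.span_le]
      rintro _ ⟨a, ha, b, hb, rfl⟩
      have ha := mem_argM.1 ha
      have hb := mem_argM.1 hb
      have := ha.2 b hb.1
      have := hb.2 a ha.1
      simp
      linarith
    have h3 := h2 h1
    simp at h3
    exact hvl (mem_argM.2 ⟨hv, fun y hy => by have := hm'.2 y hy; linarith⟩)
  · exact finrank_vectorSpan_insert_le_set ℝ _ _

theorem finrank_pos_of_ne {d : ℕ} {s : Set (Fin d → ℝ)} {x y : Fin d → ℝ} (hx : x ∈ s)
    (hy : y ∈ s) (h : x ≠ y) : 0 < Module.finrank ℝ (vectorSpan ℝ s) := by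
  rw [Module.finrank_pos_iff_exists_ne_zero]
  refine ⟨⟨x - y, vsub_mem_vectorSpan ℝ hx hy⟩, fun h0 => h ?_⟩
  have := congrArg Subtype.val h0
  exact sub_eq_zero.1 this

theorem exists_ne_of_finrank_pos {d : ℕ} {s : Finset (Fin d → ℝ)} {v : Fin d → ℝ}
    (h : 0 < Module.finrank ℝ (vectorSpan ℝ (s : Set (Fin d → ℝ)))) : ∃ x ∈ s, x ≠ v := by
  by_contra! hcon
  have : (s : Set (Fin d → ℝ)).Subsingleton := fun a ha b hb => by
    rw [hcon a ha, hcon b hb]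
  rw [vectorSpan_of_subsingleton ℝ this] at h
  simp at h

theorem edge_exists {d : ℕ} (s : Finset (Fin d → ℝ)) (hs : s.Nonempty) (m : ℕ) :
    ∀ k : (Fin d → ℝ) →L[ℝ] ℝ,
      Module.finrank ℝ (vectorSpan ℝ (argM s k : Set (Fin d → ℝ))) = m + 1 →
      ∃ l, argM s l ⊆ argM s k ∧
        Module.finrank ℝ (vectorSpan ℝ (argM s l : Set (Fin d → ℝ))) = 1 := by
  induction m with
  | zero => exact fun k hk => ⟨k, subset_rfl, hk⟩
  | succ m ih =>
    intro k hk
    obtain ⟨v, hv⟩ := argM_nonempty hs k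
    obtain ⟨g, -, hg⟩ := facet_exists (argM s k) v hv (exists_ne_of_finrank_pos (by omega))
    obtain ⟨l, hl⟩ := tilt s hs k g
    obtain ⟨l', h1, h2⟩ := ih l (by rw [hl]; omega)
    refine ⟨l', h1.trans ?_, h2⟩
    rw [hl]
    exact fun y hy => (mem_argM.1 hy).1

theorem descend {d : ℕ} (s : Finset (Fin d → ℝ)) (f h : (Fin d → ℝ) →L[ℝ] ℝ)
    (v w : Fin d → ℝ) (hv : v ∈ s) (hw : w ∈ s) (hvw : v ≠ w) (hf : f v ≤ f w)
    (hh : ∀ x ∈ s, x ≠ w → h x < h w) :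
    ∃ k, w ∈ argM s k ∧ (∃ x ∈ argM s k, x ≠ w) ∧ ∀ y ∈ argM s k, f y ≤ f w := by
  classical
  by_cases hex : ∃ x ∈ s, f x < f w
  · obtain ⟨x, hx, hxw⟩ := hex
    obtain ⟨x0, hx0, hmin⟩ := (s.filter (fun x => f x < f w)).exists_min_image
      (fun x => (h w - h x) / (f w - f x)) ⟨x, by simp [hx, hxw]⟩
    rw [Finset.mem_filter] at hx0
    set t := (h w - h x0) / (f w - f x0) with ht
    have hx0w : x0 ≠ w := by rintro rfl; exact lt_irrefl _ hx0.2
    have ht0 : 0 < t := div_pos (by linarith [hh x0 hx0.1 hx0w]) (by linarith)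
    have hx0t : t * (f w - f x0) = h w - h x0 := div_mul_cancel₀ _ (by linarith)
    have hle : ∀ y ∈ s, (h - t • f) y ≤ h w - t * f w := by
      intro y hy
      simp only [sub_apply, smul_apply, smul_eq_mul]
      by_cases hyv : f y < f w
      · have := hmin y (by simp [hy, hyv])
        rw [le_div_iff₀ (by linarith)] at this
        linarith
      · by_cases hyw : y = w
        · rw [hyw]
        · nlinarith [hh y hy hyw]
    have hwM : w ∈ argM s (h - t • f) := mem_argM.2 ⟨hw, fun y hy => (hle y hy).trans (by simp)⟩
    refine ⟨h - t • f, hwM, ⟨x0, mem_argM.2 ⟨hx0.1, fun y hy => (hle y hy).trans ?_⟩, hx0w⟩, ?_⟩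
    · simp only [sub_apply, smul_apply, smul_eq_mul]
      linarith
    · intro y hy
      by_cases hyw : y = w
      · rw [hyw]
      · have h1 := (mem_argM.1 hy).2 w hw
        simp only [sub_apply, smul_apply,
          smul_eq_mul] at h1
        have h2 := hh y (mem_argM.1 hy).1 hyw
        by_contra hcon
        nlinarith
  · push Not at hex
    refine ⟨-f, mem_argM.2 ⟨hw, fun y hy => by simpa using hex y hy⟩, ⟨v, mem_argM.2 ⟨hv,
      fun y hy => ?_⟩, hvw⟩, fun y hy => ?_⟩
    · simpa using hf.trans (hex y hy)
    · simpa using (mem_argM.1 hy).2 w hw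

/-- Every polytope is the hull of a finite set all of whose points are strictly exposed. -/
theorem reduce {d : ℕ} (s : Finset (Fin d → ℝ)) :
    ∃ t : Finset (Fin d → ℝ),
      convexHull ℝ (s : Set (Fin d → ℝ)) = convexHull ℝ (t : Set (Fin d → ℝ)) ∧
      ∀ w ∈ t, ∃ h : (Fin d → ℝ) →L[ℝ] ℝ, ∀ x ∈ t, x ≠ w → h x < h w := by
  classical
  obtain ⟨t, ht, hmin⟩ := (s.powerset.filter (fun t : Finset (Fin d → ℝ) =>
    convexHull ℝ (s : Set (Fin d → ℝ)) = convexHull ℝ (t : Set (Fin d → ℝ)))).exists_min_image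
      Finset.card ⟨s, by simp⟩
  simp only [Finset.mem_filter, Finset.mem_powerset] at ht hmin
  refine ⟨t, ht.2, fun w hw => ?_⟩
  have hnot : w ∉ convexHull ℝ ((t.erase w : Finset (Fin d → ℝ)) : Set (Fin d → ℝ)) := by
    intro hcon
    have := hmin (t.erase w) ⟨(Finset.erase_subset _ _).trans ht.1, by
      rw [ht.2]
      apply Set.Subset.antisymm
      · apply convexHull_min _ (convex_convexHull ℝ _)
        intro x hx
        by_cases hxw : x = w
        · rw [hxw]; exact hcon
        · exact subset_convexHull ℝ _ (by simpa [hxw] using hx)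
      · exact convexHull_mono (by simp)⟩
    have := Finset.card_erase_lt_of_mem hw
    omega
  obtain ⟨l, u, h1, h2⟩ := geometric_hahn_banach_closed_point (convex_convexHull ℝ _)
    (Set.Finite.isClosed_convexHull _ (t.erase w).finite_toSet) hnot
  refine ⟨l, fun x hx hxw => (h1 x (subset_convexHull ℝ _ (by simp [hx, hxw]))).trans h2⟩

/-- Let `P ⊆ ℝ^d` be a polytope of dimension `n ≥ 1` such that every edge of `P` meets
every facet of `P`.  Then `P` is a simplex. -/
theorem stmt15 {d : ℕ} (s : Finset (Fin d → ℝ)) (hs : s.Nonempty)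
    (P : Set (Fin d → ℝ)) (hP : P = convexHull ℝ (s : Set (Fin d → ℝ)))
    (n : ℕ) (hn : 1 ≤ n) (hdim : setDim P = n)
    (hmeet : ∀ E F : Set (Fin d → ℝ),
      IsPolytopeFace P E → setDim E = 1 →
      IsPolytopeFace P F → setDim F = n - 1 →
      (E ∩ F).Nonempty) :
    ∃ t : Finset (Fin d → ℝ),
      AffineIndependent ℝ (fun x : t => (x : Fin d → ℝ)) ∧
        P = convexHull ℝ (t : Set (Fin d → ℝ)) := by
  classical
  obtain ⟨t, hst, hexp⟩ := reduce s
  refine ⟨t, ?_, hP.trans hst⟩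
  rw [hst] at hP
  have htn : t.Nonempty := by
    have : (convexHull ℝ (t : Set (Fin d → ℝ))).Nonempty := by
      rw [← hst]; exact convexHull_nonempty_iff.2 hs
    exact convexHull_nonempty_iff.1 this
  subst hP
  rw [setDim_hull] at hdim
  have main : ∀ v ∈ t, ∃ (f : (Fin d → ℝ) →L[ℝ] ℝ) (c : ℝ), f v ≠ c ∧ ∀ x ∈ t, x ≠ v → f x = c := by
    intro v hv
    obtain ⟨f, hvf, hfd⟩ := facet_exists t v hv (exists_ne_of_finrank_pos (by omega))
    obtain ⟨m, hm⟩ := argM_nonempty htn f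
    have hm' := mem_argM.1 hm
    have hlt : ∀ w ∈ t, w ∉ argM t f → f w < f m := by
      intro w hw hwf
      by_contra hcon
      exact hwf (mem_argM.2 ⟨hw, fun y hy => by have := hm'.2 y hy; linarith⟩)
    -- two vertices outside the facet are impossible
    have two : ∀ a ∈ t, ∀ b ∈ t, a ≠ b → f a ≤ f b → b ∉ argM t f → False := by
      intro a ha b hb hab hfab hbf
      obtain ⟨h, hh⟩ := hexp b hb
      obtain ⟨k, hbk, ⟨x, hxk, hxb⟩, hk⟩ := descend t f h a b ha hb hab hfab hh
      have hpos := finrank_pos_of_ne (s := (argM t k : Set (Fin d → ℝ))) hxk hbk hxb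
      obtain ⟨e, he1, he2⟩ := edge_exists t htn
        (Module.finrank ℝ (vectorSpan ℝ (argM t k : Set (Fin d → ℝ))) - 1) k (by omega)
      obtain ⟨p, hpE, hpF⟩ := hmeet _ _ (face_isFace htn e) (by rw [setDim_hull, he2])
        (face_isFace htn f) (by rw [setDim_hull]; omega)
      have h1 : f p ≤ f b := le_on_hull (fun y hy => hk y (he1 hy)) hpE
      rw [face_eq htn f] at hpF
      have h2 := hpF.2 m (subset_convexHull ℝ _ hm'.1)
      have := hlt b hb hbf
      linarith
    refine ⟨f, f m, (hlt v hv hvf).ne, fun x hx hxv => ?_⟩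
    by_contra hne
    have hxf : x ∉ argM t f := fun hc =>
      hne (le_antisymm (hm'.2 x hx) ((mem_argM.1 hc).2 m hm'.1))
    rcases le_total (f x) (f v) with h | h
    · exact two x hx v hv hxv h hvf
    · exact two v hv x hx (Ne.symm hxv) h hxf
  rw [affineIndependent_iff]
  intro u w hw0 hwx i hi
  obtain ⟨f, c, hfc, hx⟩ := main i i.2
  have h1 : ∑ j ∈ u, w j * (f j - c) = 0 := by
    have h2 := congrArg f hwx
    simp only [map_sum, map_smul, smul_eq_mul, map_zero] at h2
    simp only [mul_sub, Finset.sum_sub_distrib, ← Finset.sum_mul, hw0, h2]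
    simp
  rw [Finset.sum_eq_single i] at h1
  · exact (mul_eq_zero.1 h1).resolve_right (sub_ne_zero.2 hfc)
  · intro j _ hj
    rw [hx j j.2 (fun h => hj (Subtype.ext h))]
    simp
  · exact fun h => absurd hi h
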